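/- Let K be an infinite field with char(K) = 2, Q a quiver, u, v vertices of Q, x_1, x_2, x_3 paths from u to v, and a_1, a_2, a_3 paths from v to u. Then x_1 a_1 x_2 a_2 x_3 a_3 ≡ x_3 a_1 x_1 a_2 x_2 a_3. -/

import Mathlib

open Classical BigOperators

/-- A quiver (finite oriented graph data): a type of vertices, a type of arrows,
and source (tail `a''`) and target (head `a'`) maps. -/
structure QuiverData where
  V : Type
  A : Type
  src : A → V
  tgt : A → V

namespace QuiverData

variable (Q : QuiverData)

/-- `Q.IsPathFrom u v l` : the list of arrows `l` is a (possibly empty) path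
from `u` to `v`, i.e. `l = [a₁, …, a_s]` with `a₁'' = u`, `aᵢ' = a_{i+1}''`, `a_s' = v`. -/
def IsPathFrom : Q.V → Q.V → List Q.A → Prop
  | u, v, [] => u = v
  | u, v, a :: l => Q.src a = u ∧ IsPathFrom (Q.tgt a) v l

/-- A (non-empty) closed path in the vertex `v`. -/
def IsClosedAt (v : Q.V) (l : List Q.A) : Prop :=
  l ≠ [] ∧ Q.IsPathFrom v v l

/-- A (non-empty) closed path. -/
def IsClosed (l : List Q.A) : Prop := ∃ v, Q.IsClosedAt v l

/-- `deg_w(l)`: the degree of the closed path `l` in the vertex `w`,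
i.e. the number of `i` with `aᵢ' = w`. -/
noncomputable def vdeg (l : List Q.A) (w : Q.V) : ℕ :=
  Nat.card {i : Fin l.length // Q.tgt (l.get i) = w}

/-- `deg_b(l)`: the number of occurrences of the arrow `b` in the path `l`. -/
noncomputable def adeg (l : List Q.A) (b : Q.A) : ℕ :=
  Nat.card {i : Fin l.length // l.get i = b}

/-- The number of occurrences in `l` of arrows from the set `S`. -/
noncomputable def sdeg (l : List Q.A) (S : Set Q.A) : ℕ :=
  Nat.card {i : Fin l.length // l.get i ∈ S}

/-- A primitive closed path in `v`: a closed path without self-intersections,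
i.e. `deg_w = 1` for every vertex `w` of the path. -/
def IsPrimitiveAt (v : Q.V) (l : List Q.A) : Prop :=
  Q.IsClosedAt v l ∧ ∀ a ∈ l, Q.vdeg l (Q.tgt a) = 1

/-- A primitive closed path. -/
def IsPrimitive (l : List Q.A) : Prop := ∃ v, Q.IsPrimitiveAt v l

/-- `m(Q) = m` : `m` is the maximal degree of primitive closed paths in `Q`. -/
def MaxPrimDeg (m : ℕ) : Prop :=
  (∃ l, Q.IsPrimitive l ∧ l.length = m) ∧ ∀ l, Q.IsPrimitive l → l.length ≤ m

/-- `Q` is strongly connected: there is a closed path containing all vertices;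
a quiver with one vertex and no arrows is also strongly connected. -/
def StronglyConnected : Prop :=
  (∃ v l, Q.IsClosedAt v l ∧ ∀ w, ∃ a ∈ l, Q.tgt a = w) ∨
    (Subsingleton Q.V ∧ IsEmpty Q.A)

/-- Formal negation on the set (closed paths with a formal sign) ∪ {0};
`none` is the symbol `0`, and `some (e, l)` is `(-1)^e·l`. -/
def negO : Option (Bool × List Q.A) → Option (Bool × List Q.A)
  | none => none
  | some (e, l) => some (!e, l)

/-- The equivalence `≡` on the set of closed paths of `Q`, enlarged by an additional
symbol `0` (represented by `none`) and formal signs (`some (e, l)` is `(-1)^e·l`).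
The parameter `c2` is the proposition "the characteristic of the ground field is 2"
(so that the formal sign `(-1)^σ` is trivial exactly when `c2` holds).
It is the smallest equivalence, compatible with formal negation, such that for paths
`a`, `b` with `ab` a closed path and incident closed paths `a₁, a₂, …`:
(1) `ab ≡ ba`; (2) `a_{σ(1)}⋯a_{σ(t)} ≡ (-1)^σ a₁⋯a_t` for `t ≥ 2` and `σ ∈ S_t`
(generated here by transpositions of adjacent factors);
(3) `a₁²a₂ ≡ 0`; (4) if `c2` then `a₁² ≡ 0`, while if `¬c2` then `a₁a₂a₃a₄ ≡ 0`. -/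
inductive PEquiv (c2 : Prop) : Option (Bool × List Q.A) → Option (Bool × List Q.A) → Prop
  | refl (x) : PEquiv c2 x x
  | symm {x y} : PEquiv c2 x y → PEquiv c2 y x
  | trans {x y z} : PEquiv c2 x y → PEquiv c2 y z → PEquiv c2 x z
  | neg {x y} : PEquiv c2 x y → PEquiv c2 (Q.negO x) (Q.negO y)
  | cyc (u v : Q.V) (a b : List Q.A) (e : Bool) :
      Q.IsPathFrom u v a → Q.IsPathFrom v u b → a ++ b ≠ [] →
      PEquiv c2 (some (e, a ++ b)) (some (e, b ++ a))
  | swap (v : Q.V) (w₁ c d w₂ : List Q.A) (e : Bool) :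
      Q.IsPathFrom v v w₁ → Q.IsClosedAt v c → Q.IsClosedAt v d → Q.IsPathFrom v v w₂ →
      PEquiv c2 (some (e, w₁ ++ c ++ d ++ w₂))
        (some (if c2 then e else !e, w₁ ++ d ++ c ++ w₂))
  | sq_mul (v : Q.V) (c d : List Q.A) (e : Bool) :
      Q.IsClosedAt v c → Q.IsClosedAt v d →
      PEquiv c2 (some (e, c ++ c ++ d)) none
  | sq (v : Q.V) (c : List Q.A) (e : Bool) :
      c2 → Q.IsClosedAt v c → PEquiv c2 (some (e, c ++ c)) none
  | four (v : Q.V) (c₁ c₂ c₃ c₄ : List Q.A) (e : Bool) :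
      ¬c2 → Q.IsClosedAt v c₁ → Q.IsClosedAt v c₂ → Q.IsClosedAt v c₃ → Q.IsClosedAt v c₄ →
      PEquiv c2 (some (e, c₁ ++ c₂ ++ c₃ ++ c₄)) none
  | sign_triv (e : Bool) (l : List Q.A) :
      c2 → PEquiv c2 (some (e, l)) (some (!e, l))

/-- `l₁ ≡ l₂` for closed paths. -/
def PathEquiv (c2 : Prop) (l₁ l₂ : List Q.A) : Prop :=
  Q.PEquiv c2 (some (false, l₁)) (some (false, l₂))

/-- `l ≡ 0`. -/
def EquivZero (c2 : Prop) (l : List Q.A) : Prop :=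
  Q.PEquiv c2 (some (false, l)) none

/-! ### Invariants of quivers for the dimension vector `(2,…,2)` -/

/-- Variables `x_{ij}(a)` of the polynomial ring: for each arrow `a` the entries of the
`2 × 2` generic matrix `X_a`. -/
def Var : Type := Q.A × Fin 2 × Fin 2

variable (K : Type) [Field K]

/-- The substitution describing the base-change action of the group
`∏_{v} GL₂(K)` (given by a family of invertible matrices `g`) on the variables:
`x_{ij}(a)` is sent to the `(i,j)` entry of `g_{a'} X_a g_{a''}⁻¹`. -/
noncomputable def actVar (g : Q.V → Matrix (Fin 2) (Fin 2) K) (p : Q.Var) :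
    MvPolynomial Q.Var K :=
  ∑ k : Fin 2, ∑ l : Fin 2,
    MvPolynomial.C (g (Q.tgt p.1) p.2.1 k * (g (Q.src p.1))⁻¹ l p.2.2) *
      MvPolynomial.X (p.1, k, l)

/-- `f` belongs to the algebra of invariants `Inv(Q,(2,…,2))`. -/
def IsInvariant (f : MvPolynomial Q.Var K) : Prop :=
  ∀ g : Q.V → Matrix (Fin 2) (Fin 2) K, (∀ v, IsUnit (g v).det) →
    MvPolynomial.aeval (Q.actVar K g) f = f

/-- The space `Inv(Q,(2,…,2))⁺` of invariants without constant term (the span of the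
homogeneous invariants of positive degree). -/
def PlusSet : Set (MvPolynomial Q.Var K) :=
  {f | Q.IsInvariant K f ∧ MvPolynomial.constantCoeff f = 0}

/-- `f` is decomposable: it lies in the ideal `(Inv⁺)²`, i.e. in the `K`-span of
products of two invariants of positive degree. -/
def Decomposable (f : MvPolynomial Q.Var K) : Prop :=
  f ∈ Submodule.span K
    {x : MvPolynomial Q.Var K | ∃ p ∈ Q.PlusSet K, ∃ q ∈ Q.PlusSet K, x = p * q}

/-- The generic `2 × 2` matrix `X_a` of an arrow `a`. -/
noncomputable def genMat (a : Q.A) : Matrix (Fin 2) (Fin 2) (MvPolynomial Q.Var K) :=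
  Matrix.of fun i j => MvPolynomial.X (a, i, j)

/-- For a path `l = a₁⋯a_s`, the matrix product `X_{a_s} ⋯ X_{a_1}`. -/
noncomputable def pathMat (l : List Q.A) : Matrix (Fin 2) (Fin 2) (MvPolynomial Q.Var K) :=
  ((l.map (Q.genMat K)).reverse).prod

/-- `tr(X_{a_s} ⋯ X_{a_1})` for a path `l = a₁⋯a_s`. -/
noncomputable def pathTr (l : List Q.A) : MvPolynomial Q.Var K :=
  Matrix.trace (Q.pathMat K l)

/-- `det(X_{a_s} ⋯ X_{a_1})` for a path `l = a₁⋯a_s`. -/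
noncomputable def pathDet (l : List Q.A) : MvPolynomial Q.Var K :=
  Matrix.det (Q.pathMat K l)

/-- `σ_k(X_{a_s} ⋯ X_{a_1})`, the `k`-th coefficient of the characteristic polynomial
of the `2 × 2` matrix `X_{a_s} ⋯ X_{a_1}` (which vanishes for `k > 2`). -/
noncomputable def pathSigma (k : ℕ) (l : List Q.A) : MvPolynomial Q.Var K :=
  if k = 0 then 1 else if k = 1 then Q.pathTr K l
    else if k = 2 then Q.pathDet K l else 0

/-- `D(Q,(2,…,2))`: the maximal degree of an indecomposable homogeneous invariant,
i.e. the least upper bound for the degrees of elements of a minimal homogeneous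
system of generators of `Inv(Q,(2,…,2))`. -/
noncomputable def Dnum : ℕ :=
  sSup {k | ∃ f : MvPolynomial Q.Var K,
    Q.IsInvariant K f ∧ f.IsHomogeneous k ∧ ¬ Q.Decomposable K f}

end QuiverData

/-- `max {D(Q,(2,…,2)) | Q ∈ 𝒬(n,d,m)}` where `𝒬(n,d,m)` is the set of strongly
connected quivers with `n` vertices (vertex set `Fin n`), `d` arrows (arrow set `Fin d`)
and maximal degree of primitive closed paths equal to `m`. -/
noncomputable def QuiverData.maxD (K : Type) [Field K] (n d m : ℕ) : ℕ :=
  sSup {N | ∃ s t : Fin d → Fin n,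
    (QuiverData.mk (Fin n) (Fin d) s t).StronglyConnected ∧
    (QuiverData.mk (Fin n) (Fin d) s t).MaxPrimDeg m ∧
    N = (QuiverData.mk (Fin n) (Fin d) s t).Dnum K}

theorem QuiverData.IsPathFrom.append {Q : QuiverData} {v w : Q.V} {l₂ : List Q.A}
    (h₂ : Q.IsPathFrom v w l₂) :
    ∀ {l₁ : List Q.A} {u : Q.V}, Q.IsPathFrom u v l₁ → Q.IsPathFrom u w (l₁ ++ l₂)
  | [], u, h => by
      have h' : u = v := h
      subst h'
      exact h₂
  | _ :: _, _, h => ⟨h.1, h₂.append h.2⟩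

/-- **Lemma (star, part 1).** Let `char K = 2`, `u`, `v` vertices of `Q`,
`x₁, x₂, x₃` paths from `u` to `v` and `a₁, a₂, a₃` paths from `v` to `u`.
Then `x₁a₁x₂a₂x₃a₃ ≡ x₃a₁x₁a₂x₂a₃`. -/
theorem star_part_one
    (K : Type) [Field K] [Infinite K] (hchar : ringChar K = 2)
    (Q : QuiverData) (u v : Q.V)
    (x₁ x₂ x₃ a₁ a₂ a₃ : List Q.A)
    (hx₁ : Q.IsPathFrom u v x₁) (hx₂ : Q.IsPathFrom u v x₂) (hx₃ : Q.IsPathFrom u v x₃)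
    (ha₁ : Q.IsPathFrom v u a₁) (ha₂ : Q.IsPathFrom v u a₂) (ha₃ : Q.IsPathFrom v u a₃)
    (hx₁ne : x₁ ≠ []) (hx₂ne : x₂ ≠ []) (hx₃ne : x₃ ≠ [])
    (ha₁ne : a₁ ≠ []) (ha₂ne : a₂ ≠ []) (ha₃ne : a₃ ≠ []) :
    Q.PathEquiv (ringChar K = 2)
      (x₁ ++ a₁ ++ x₂ ++ a₂ ++ x₃ ++ a₃)
      (x₃ ++ a₁ ++ x₁ ++ a₂ ++ x₂ ++ a₃) := by
  have c₁ : Q.IsClosedAt v (a₁ ++ x₂) := ⟨by simp [ha₁ne], hx₂.append ha₁⟩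
  have c₂ : Q.IsClosedAt v (a₂ ++ x₃) := ⟨by simp [ha₂ne], hx₃.append ha₂⟩
  have c₃ : Q.IsPathFrom v v (a₃ ++ x₁) := hx₁.append ha₃
  have d₁ : Q.IsPathFrom u u (x₃ ++ a₁) := ha₁.append hx₃
  have d₂ : Q.IsClosedAt u (x₂ ++ a₃) := ⟨by simp [hx₂ne], ha₃.append hx₂⟩
  have d₃ : Q.IsClosedAt u (x₁ ++ a₂) := ⟨by simp [hx₁ne], ha₂.append hx₁⟩
  have s₁ := QuiverData.PEquiv.cyc (c2 := ringChar K = 2) u v x₁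
    ((a₁ ++ x₂) ++ (a₂ ++ x₃) ++ a₃) false hx₁ (ha₃.append (c₂.2.append c₁.2)) (by simp [hx₁ne])
  have s₂ := QuiverData.PEquiv.swap (c2 := ringChar K = 2) v [] (a₁ ++ x₂) (a₂ ++ x₃) (a₃ ++ x₁) false
    rfl c₁ c₂ c₃
  have s₃ := QuiverData.PEquiv.cyc (c2 := ringChar K = 2) v u a₂
    (x₃ ++ a₁ ++ (x₂ ++ a₃) ++ x₁) false ha₂ (hx₁.append (d₂.2.append d₁)) (by simp [ha₂ne])
  have s₄ := QuiverData.PEquiv.swap (c2 := ringChar K = 2) u (x₃ ++ a₁) (x₂ ++ a₃) (x₁ ++ a₂) [] false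
    d₁ d₂ d₃ rfl
  unfold QuiverData.PathEquiv
  simp only [if_pos hchar, List.append_assoc, List.nil_append, List.append_nil] at s₁ s₂ s₃ s₄ ⊢
  exact ((s₁.trans s₂).trans s₃).trans s₄
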